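/- Let n ≥ 1, let B be a nonnegative elasticity tensor, and let x, y ∈ ℝ^n with xᵀx = yᵀy = 1 satisfy B x² y² = ρ_M(B). Then B |x|² |y|² = ρ_M(B), where |x| and |y| denote the componentwise absolute values of x and y; that is, the supremum defining ρ_M(B) is also attained at the pair of nonnegative unit vectors (|x|, |y|). -/

import Mathlib

open Finset

noncomputable section

/-- Symmetry condition of an elasticity tensor: `a_{ijkl} = a_{jikl} = a_{ijlk}`. -/
def ElastSym {n : ℕ} (A : Fin n → Fin n → Fin n → Fin n → ℝ) : Prop :=
  ∀ i j k l, A i j k l = A j i k l ∧ A i j k l = A i j l k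

/-- The scalar `A x² y² = ∑ a_{ijkl} x_i x_j y_k y_l`. -/
def tQuad {n : ℕ} (A : Fin n → Fin n → Fin n → Fin n → ℝ) (x y : Fin n → ℝ) : ℝ :=
  ∑ i, ∑ j, ∑ k, ∑ l, A i j k l * x i * x j * y k * y l

/-- The vector `(A x y²)_i = ∑ a_{ijkl} x_j y_k y_l`. -/
def tAxyy {n : ℕ} (A : Fin n → Fin n → Fin n → Fin n → ℝ) (x y : Fin n → ℝ) : Fin n → ℝ :=
  fun i => ∑ j, ∑ k, ∑ l, A i j k l * x j * y k * y l

/-- The vector `(A x² y)_l = ∑ a_{ijkl} x_i x_j y_k`. -/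
def tAxxy {n : ℕ} (A : Fin n → Fin n → Fin n → Fin n → ℝ) (x y : Fin n → ℝ) : Fin n → ℝ :=
  fun l => ∑ i, ∑ j, ∑ k, A i j k l * x i * x j * y k

/-- The matrix `(A x²)_{kl} = ∑ a_{ijkl} x_i x_j`. -/
def matAx2 {n : ℕ} (A : Fin n → Fin n → Fin n → Fin n → ℝ) (x : Fin n → ℝ) :
    Matrix (Fin n) (Fin n) ℝ :=
  Matrix.of fun k l => ∑ i, ∑ j, A i j k l * x i * x j

/-- The matrix `(A y²)_{ij} = ∑ a_{ijkl} y_k y_l`. -/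
def matAy2 {n : ℕ} (A : Fin n → Fin n → Fin n → Fin n → ℝ) (y : Fin n → ℝ) :
    Matrix (Fin n) (Fin n) ℝ :=
  Matrix.of fun i j => ∑ k, ∑ l, A i j k l * y k * y l

/-- The identity tensor `e_{ijkl} = 1` iff `i = j` and `k = l`. -/
def idT (n : ℕ) : Fin n → Fin n → Fin n → Fin n → ℝ :=
  fun i j k l => if i = j ∧ k = l then 1 else 0

/-- `xᵀ x = 1`. -/
def unitVec {n : ℕ} (x : Fin n → ℝ) : Prop := ∑ i, x i * x i = 1

/-- `(λ, x, y)` is an M-eigenpair of `A`. -/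
def IsMEig {n : ℕ} (A : Fin n → Fin n → Fin n → Fin n → ℝ) (lam : ℝ) (x y : Fin n → ℝ) :
    Prop :=
  (∀ i, tAxyy A x y i = lam * x i) ∧ (∀ l, tAxxy A x y l = lam * y l) ∧
    unitVec x ∧ unitVec y

/-- M-positive definiteness (the strong ellipticity condition). -/
def MPD {n : ℕ} (A : Fin n → Fin n → Fin n → Fin n → ℝ) : Prop :=
  ∀ x y : Fin n → ℝ, x ≠ 0 → y ≠ 0 → 0 < tQuad A x y

/-- M-positive semidefiniteness. -/
def MPSD {n : ℕ} (A : Fin n → Fin n → Fin n → Fin n → ℝ) : Prop :=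
  ∀ x y : Fin n → ℝ, 0 ≤ tQuad A x y

/-- All entries are nonnegative. -/
def NonnegT {n : ℕ} (A : Fin n → Fin n → Fin n → Fin n → ℝ) : Prop :=
  ∀ i j k l, 0 ≤ A i j k l

/-- The M-spectral radius of a nonnegative elasticity tensor:
`sup { B x² y² : xᵀx = yᵀy = 1 }`. -/
def rhoM {n : ℕ} (B : Fin n → Fin n → Fin n → Fin n → ℝ) : ℝ :=
  sSup { r : ℝ | ∃ x y : Fin n → ℝ, unitVec x ∧ unitVec y ∧ r = tQuad B x y }

/-- An elasticity Z-tensor: all off-diagonal entries nonpositive. -/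
def ZTensor {n : ℕ} (A : Fin n → Fin n → Fin n → Fin n → ℝ) : Prop :=
  ∀ i j k l, ¬(i = j ∧ k = l) → A i j k l ≤ 0

/-- A nonsingular elasticity M-tensor: `A = s E - B` with `B` nonnegative and `s > ρ_M(B)`. -/
def NonsingMT {n : ℕ} (A : Fin n → Fin n → Fin n → Fin n → ℝ) : Prop :=
  ∃ (s : ℝ) (B : Fin n → Fin n → Fin n → Fin n → ℝ),
    ElastSym B ∧ NonnegT B ∧ (∀ i j k l, A i j k l = s * idT n i j k l - B i j k l) ∧
      rhoM B < s

/-- An elasticity M-tensor: `A = s E - B` with `B` nonnegative and `s ≥ ρ_M(B)`. -/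
def ElastMT {n : ℕ} (A : Fin n → Fin n → Fin n → Fin n → ℝ) : Prop :=
  ∃ (s : ℝ) (B : Fin n → Fin n → Fin n → Fin n → ℝ),
    ElastSym B ∧ NonnegT B ∧ (∀ i j k l, A i j k l = s * idT n i j k l - B i j k l) ∧
      rhoM B ≤ s

/-- Irreducibility of a (nonnegative) square matrix. -/
def MatIrred {n : ℕ} (M : Matrix (Fin n) (Fin n) ℝ) : Prop :=
  ∀ S : Finset (Fin n), S.Nonempty → S ≠ Finset.univ → ∃ k ∈ S, ∃ l ∉ S, M k l ≠ 0

/-- Strict diagonal dominance. -/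
def SDD {n : ℕ} (M : Matrix (Fin n) (Fin n) ℝ) : Prop :=
  ∀ i, ∑ j ∈ Finset.univ.erase i, |M i j| < |M i i|

theorem unitVec.abs_apply_le_one {n : ℕ} {x : Fin n → ℝ} (hx : unitVec x) (i : Fin n) :
    |x i| ≤ 1 := by
  rw [← sq_le_one_iff_abs_le_one, sq, ← hx]
  exact Finset.single_le_sum (f := fun i => x i * x i) (fun j _ => mul_self_nonneg (x j))
    (Finset.mem_univ i)

theorem unitVec.abs {n : ℕ} {x : Fin n → ℝ} (hx : unitVec x) : unitVec fun i => |x i| := by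
  simpa [unitVec] using hx

theorem tQuad_le_tQuad_abs {n : ℕ} {B : Fin n → Fin n → Fin n → Fin n → ℝ} (hB : NonnegT B)
    (x y : Fin n → ℝ) : tQuad B x y ≤ tQuad B (fun i => |x i|) (fun i => |y i|) := by
  unfold tQuad
  refine Finset.sum_le_sum fun i _ => Finset.sum_le_sum fun j _ => Finset.sum_le_sum fun k _ =>
    Finset.sum_le_sum fun l _ => ?_
  calc B i j k l * x i * x j * y k * y l ≤ |B i j k l * x i * x j * y k * y l| := le_abs_self _
    _ = B i j k l * |x i| * |x j| * |y k| * |y l| := by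
      simp only [abs_mul, abs_of_nonneg (hB i j k l)]

theorem tQuad_abs_le_sum {n : ℕ} {B : Fin n → Fin n → Fin n → Fin n → ℝ} (hB : NonnegT B)
    {x y : Fin n → ℝ} (hx : unitVec x) (hy : unitVec y) :
    tQuad B (fun i => |x i|) (fun i => |y i|) ≤ ∑ i, ∑ j, ∑ k, ∑ l, B i j k l := by
  unfold tQuad
  gcongr with i _ j _ k _ l _
  have h₀ := hB i j k l
  calc B i j k l * |x i| * |x j| * |y k| * |y l| ≤ B i j k l * 1 * 1 * 1 * 1 := by
        gcongr
        exacts [hx.abs_apply_le_one i, hx.abs_apply_le_one j, hy.abs_apply_le_one k,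
          hy.abs_apply_le_one l]
    _ = B i j k l := by ring

theorem tQuad_le_rhoM {n : ℕ} {B : Fin n → Fin n → Fin n → Fin n → ℝ} (hB : NonnegT B)
    {x y : Fin n → ℝ} (hx : unitVec x) (hy : unitVec y) : tQuad B x y ≤ rhoM B := by
  refine le_csSup ⟨∑ i, ∑ j, ∑ k, ∑ l, B i j k l, ?_⟩ ⟨x, y, hx, hy, rfl⟩
  rintro _ ⟨u, v, hu, hv, rfl⟩
  exact (tQuad_le_tQuad_abs hB u v).trans (tQuad_abs_le_sum hB hu hv)

/-- if unit vectors `x, y` attain `ρ_M(B)` for nonnegative `B`, then so do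
the nonnegative unit vectors `|x|, |y|`. -/
theorem stmt_6 {n : ℕ} (hn : 1 ≤ n) (B : Fin n → Fin n → Fin n → Fin n → ℝ)
    (hB : ElastSym B) (hnn : NonnegT B)
    (x y : Fin n → ℝ) (hx : unitVec x) (hy : unitVec y)
    (h : tQuad B x y = rhoM B) :
    tQuad B (fun i => |x i|) (fun i => |y i|) = rhoM B := by
  exact (tQuad_le_rhoM hnn hx.abs hy.abs).antisymm (h ▸ tQuad_le_tQuad_abs hnn x y)
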